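/- Let f ∈ C³(𝕋) and g ∈ C²(𝕋) be real-valued. Then the operator [T_g, T_f] X + X [T_g, T_f] (defined as the bounded extension of the corresponding sesquilinear form on the span of the canonical basis) is a compact operator on ℓ²(ℕ). -/

import Mathlib

open scoped InnerProductSpace
open Complex

noncomputable section

/-- The `n`-th Fourier coefficient of a `2π`-periodic function `f : ℝ → ℂ`. -/
def fcoef (f : ℝ → ℂ) (n : ℤ) : ℂ :=
  (1 / (2 * Real.pi)) • ∫ θ in (0:ℝ)..(2 * Real.pi), Complex.exp (-Complex.I * n * θ) * f θ

variable {E : Type*} [NormedAddCommGroup E] [InnerProductSpace ℂ E] [CompleteSpace E]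

/-- `e` is the canonical orthonormal (Hilbert) basis of `ℓ²(ℕ)`, abstractly:
an orthonormal family with dense span. -/
def IsONBasis (e : ℕ → E) : Prop :=
  Orthonormal ℂ e ∧ (Submodule.span ℂ (Set.range e)).topologicalClosure = ⊤

/-- `T` is the Toeplitz operator with symbol `f`: `⟪e n, T (e k)⟫ = f̂(n−k)`. -/
def IsToeplitz (e : ℕ → E) (f : ℝ → ℂ) (T : E →L[ℂ] E) : Prop :=
  ∀ n k : ℕ, ⟪e n, T (e k)⟫_ℂ = fcoef f ((n : ℤ) - k)

/-- `T` is the Hankel operator with symbol `f`: `⟪e n, T (e k)⟫ = f̂(n+k+1)`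
(0-based indexing of the paper's `f̂_{n+k-1}`, `n, k ≥ 1`). -/
def IsHankel (e : ℕ → E) (f : ℝ → ℂ) (T : E →L[ℂ] E) : Prop :=
  ∀ n k : ℕ, ⟪e n, T (e k)⟫_ℂ = fcoef f ((n : ℤ) + k + 1)

/-- `X` is the (self-adjoint) position operator: `X e_n = (n+1) e_n` (0-based). -/
def IsPosOp (e : ℕ → E) (X : E →ₗ.[ℂ] E) : Prop :=
  X.adjoint = X ∧ ∀ q : ℕ, ∃ hq : e q ∈ X.domain, X ⟨e q, hq⟩ = ((q : ℂ) + 1) • e q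

/-- `A` is the self-adjoint operator `A_g`, the closure of `½(T_g X + X T_g)`;
being essentially self-adjoint, it is the unique self-adjoint operator with
matrix elements `((p+q+2)/2)·ĝ(p−q)` on the canonical basis (0-based). -/
def IsAg (e : ℕ → E) (g : ℝ → ℂ) (A : E →ₗ.[ℂ] E) : Prop :=
  A.adjoint = A ∧ ∀ q : ℕ, ∃ hq : e q ∈ A.domain, ∀ p : ℕ,
    ⟪e p, A ⟨e q, hq⟩⟫_ℂ = (((p : ℂ) + q + 2) / 2) * fcoef g ((p : ℤ) - q)

/-- `C = ad_A B`: the commutator form of `A` and `B` on `D(A) × D(A)` is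
represented by the bounded operator `C`; in particular `B ∈ C¹(A)`. -/
def CommutatorOf (A : E →ₗ.[ℂ] E) (B C : E →L[ℂ] E) : Prop :=
  ∀ φ ψ : A.domain, ⟪A φ, B (ψ : E)⟫_ℂ - ⟪(φ : E), B (A ψ)⟫_ℂ = ⟪(φ : E), C (ψ : E)⟫_ℂ

lemma hasSum_congr_aux {u v : ℕ → ℂ} {s : ℂ} (h : ∀ j, u j = v j) (hv : HasSum v s) :
    HasSum u s := by
  rwa [funext h]

lemma fcoef_deriv_aux (f : ℝ → ℝ) (hf : ContDiff ℝ 1 f)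
    (hfp : Function.Periodic f (2 * Real.pi)) (n : ℤ) :
    fcoef (fun x => Complex.ofReal (deriv f x)) n
      = Complex.I * n * fcoef (fun x => Complex.ofReal (f x)) n := by
  have hd : ∀ x, HasDerivAt (fun x => Complex.ofReal (f x)) (Complex.ofReal (deriv f x)) x :=
    fun x => ((hf.differentiable (by norm_num) x).hasDerivAt).ofReal_comp
  have hc : Continuous (deriv f) := hf.continuous_deriv (by norm_num)
  have he : ∀ x : ℝ, HasDerivAt (fun θ : ℝ => Complex.exp (-Complex.I * n * θ))
      (Complex.exp (-Complex.I * n * x) * (-Complex.I * n)) x := by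
    intro x
    have h1 : HasDerivAt (fun θ : ℝ => -Complex.I * n * (θ : ℂ)) (-Complex.I * n) x := by
      simpa using (Complex.ofRealCLM.hasDerivAt (x := x)).const_mul (-Complex.I * (n : ℂ))
    exact h1.cexp
  have key := intervalIntegral.integral_mul_deriv_eq_deriv_mul (a := 0) (b := 2 * Real.pi)
    (fun x _ => he x) (fun x _ => hd x)
    (Continuous.intervalIntegrable (by fun_prop) _ _)
    (Continuous.intervalIntegrable (by fun_prop) _ _)
  have h0 : f (2 * Real.pi) = f 0 := by simpa using hfp 0
  have h2 : Complex.exp (-Complex.I * n * ((2 * Real.pi : ℝ) : ℂ)) = 1 := by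
    rw [Complex.exp_eq_one_iff]
    exact ⟨-n, by push_cast; ring⟩
  have h3 : ∀ x : ℝ, Complex.exp (-Complex.I * n * x) * (-Complex.I * n) * (f x : ℂ)
      = (-Complex.I * n) * (Complex.exp (-Complex.I * n * x) * (f x : ℂ)) := fun x => by ring
  unfold fcoef
  rw [key, h0, h2]
  simp_rw [h3]
  rw [intervalIntegral.integral_const_mul]
  simp
  ring

lemma fcoef_decay (k : ℕ) : ∀ (f : ℝ → ℝ), ContDiff ℝ k f →
    Function.Periodic f (2 * Real.pi) →
    ∃ C : ℝ, 0 ≤ C ∧ ∀ n : ℤ, |(n : ℝ)| ^ k * ‖fcoef (fun x => Complex.ofReal (f x)) n‖ ≤ C := by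
  induction k with
  | zero =>
    intro f hf hfp
    refine ⟨‖(1 / (2 * Real.pi) : ℝ)‖ * abs (∫ θ in (0:ℝ)..(2 * Real.pi), abs (f θ)), by positivity, ?_⟩
    intro n
    rw [pow_zero, one_mul]
    unfold fcoef
    rw [norm_smul]
    gcongr
    refine (intervalIntegral.norm_integral_le_abs_integral_norm).trans (le_of_eq ?_)
    congr 2
    ext θ
    rw [norm_mul]
    have : -Complex.I * n * (θ : ℂ) = ((-(n * θ) : ℝ) : ℂ) * Complex.I := by push_cast; ring
    rw [this, Complex.norm_exp_ofReal_mul_I]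
    simp
  | succ k ih =>
    intro f hf hfp
    have hf1 : ContDiff ℝ 1 f := hf.of_le (by norm_cast; omega)
    have hp' : Function.Periodic (deriv f) (2 * Real.pi) := by
      intro x
      rw [← deriv_comp_add_const, show (fun x => f (x + 2 * Real.pi)) = f from funext hfp]
    have hd : ContDiff ℝ k (deriv f) := by
      have : ContDiff ℝ ((k : WithTop ℕ∞) + 1) f := by exact_mod_cast hf
      exact (contDiff_succ_iff_deriv.1 this).2.2
    obtain ⟨C, hC, h⟩ := ih (deriv f) hd hp'
    refine ⟨C, hC, fun n => ?_⟩
    have := h n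
    rw [fcoef_deriv_aux f hf1 hfp n] at this
    refine le_trans (le_of_eq ?_) this
    rw [norm_mul, norm_mul]
    simp
    ring

lemma exists_vec (b : HilbertBasis ℕ ℂ E) : ∃ K : ℝ, 0 ≤ K ∧
    ∀ (u : ℕ → ℂ) (M : ℝ), 0 ≤ M → (∀ p : ℕ, ‖u p‖ ≤ M / (p + 1)) →
      ∃ v : E, (∀ p, ⟪b p, v⟫_ℂ = u p) ∧ ‖v‖ ≤ M * K := by
  have hs : Summable (fun p : ℕ => 1 / ((p : ℝ) + 1) ^ 2) := by
    have := (summable_nat_add_iff 1).2 (Real.summable_one_div_nat_pow.2 (by norm_num : 1 < 2))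
    simpa using this
  refine ⟨Real.sqrt (∑' p : ℕ, 1 / ((p : ℝ) + 1) ^ 2), Real.sqrt_nonneg _, ?_⟩
  intro u M hM hu
  have hle : ∀ p, ‖u p‖ ^ 2 ≤ M ^ 2 * (1 / ((p : ℝ) + 1) ^ 2) := by
    intro p
    calc ‖u p‖ ^ 2 ≤ (M / (p + 1)) ^ 2 := by gcongr; exact hu p
      _ = _ := by rw [div_pow]; ring
  have hsu : Summable (fun p => ‖u p‖ ^ 2) :=
    Summable.of_nonneg_of_le (fun _ => by positivity) hle (hs.mul_left _)
  have hmem : Memℓp u 2 := memℓp_gen (by simpa using hsu)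
  let w : lp (fun _ : ℕ => ℂ) 2 := ⟨u, hmem⟩
  refine ⟨b.repr.symm w, fun p => ?_, ?_⟩
  · rw [← b.repr_apply_apply, LinearIsometryEquiv.apply_symm_apply]
  · rw [LinearIsometryEquiv.norm_map]
    refine lp.norm_le_of_tsum_le (by norm_num) (by positivity) ?_
    have h1 : ∑' p, ‖u p‖ ^ 2 ≤ (M * Real.sqrt (∑' p : ℕ, 1 / ((p : ℝ) + 1) ^ 2)) ^ 2 := by
      rw [mul_pow, Real.sq_sqrt (tsum_nonneg fun _ => by positivity), ← tsum_mul_left]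
      exact hsu.tsum_le_tsum hle (hs.mul_left _)
    simpa using h1

lemma compact_rankOne (x y : E) :
    IsCompactOperator ⇑(InnerProductSpace.rankOne ℂ x y : E →L[ℂ] E) := by
  have hid : IsCompactOperator (ContinuousLinearMap.id ℂ ℂ) :=
    ⟨Metric.closedBall 0 1, isCompact_closedBall 0 1, Metric.closedBall_mem_nhds 0 one_pos⟩
  exact (hid.clm_comp (ContinuousLinearMap.toSpanSingleton ℂ x)).comp_clm (innerSL ℂ y)

lemma exists_compact (b : HilbertBasis ℕ ℂ E) (u v : ℕ → ℕ → ℂ) (M N : ℕ → ℝ)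
    (hM : ∀ j, 0 ≤ M j) (hN : ∀ j, 0 ≤ N j)
    (hu : ∀ j p : ℕ, ‖u j p‖ ≤ M j / (p + 1)) (hv : ∀ j p : ℕ, ‖v j p‖ ≤ N j / (p + 1))
    (hs : Summable fun j => M j * N j) :
    ∃ B : E →L[ℂ] E, IsCompactOperator ⇑B ∧
      ∀ p q, HasSum (fun j => u j p * v j q) ⟪b p, B (b q)⟫_ℂ := by
  obtain ⟨K, hK, hvec⟩ := exists_vec b
  choose x hx hxn using fun j => hvec (u j) (M j) (hM j) (hu j)
  choose y hy hyn using fun j => hvec (fun q => (starRingEnd ℂ) (v j q)) (N j) (hN j)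
    (by intro p; simpa using hv j p)
  let R : ℕ → E →L[ℂ] E := fun j => InnerProductSpace.rankOne ℂ (x j) (y j)
  have hR : Summable R := by
    refine Summable.of_norm_bounded (hs.mul_right (K * K)) fun j => ?_
    simp only [R, InnerProductSpace.norm_rankOne]
    calc ‖x j‖ * ‖y j‖ ≤ (M j * K) * (N j * K) :=
          mul_le_mul (hxn j) (hyn j) (norm_nonneg _) (mul_nonneg (hM j) hK)
      _ = _ := by ring
  refine ⟨∑' j, R j, ?_, ?_⟩
  · refine isCompactOperator_of_tendsto hR.hasSum (Filter.Eventually.of_forall fun s => ?_)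
    have : (∑ j ∈ s, R j) ∈ compactOperator (RingHom.id ℂ) E E :=
      Submodule.sum_mem _ fun j _ => compact_rankOne (x j) (y j)
    exact this
  · intro p q
    have h1 := hR.hasSum.mapL
      ((innerSL ℂ (b p)).comp (ContinuousLinearMap.apply ℂ E (b q)))
    refine hasSum_congr_aux (fun j => ?_) h1
    have h2 : ⟪y j, b q⟫_ℂ = v j q := by
      rw [← inner_conj_symm, hy]; simp
    simp [R, inner_smul_right, hx, h2, mul_comm]

lemma commutator_hasSum (b : HilbertBasis ℕ ℂ E) (α β : ℤ → ℂ) (Tf Tg : E →L[ℂ] E)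
    (hTf : ∀ n k : ℕ, ⟪b n, Tf (b k)⟫_ℂ = α ((n : ℤ) - k))
    (hTg : ∀ n k : ℕ, ⟪b n, Tg (b k)⟫_ℂ = β ((n : ℤ) - k)) (p q : ℕ) (s t : ℂ)
    (hs : HasSum (fun j : ℕ => α (p + j + 1) * β (-(q + j + 1))) s)
    (ht : HasSum (fun j : ℕ => β (p + j + 1) * α (-(q + j + 1))) t) :
    ⟪b p, (Tg ∘L Tf - Tf ∘L Tg) (b q)⟫_ℂ = s - t := by
  have prod : ∀ (α β : ℤ → ℂ) (Tf Tg : E →L[ℂ] E)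
    (_ : ∀ n k : ℕ, ⟪b n, Tf (b k)⟫_ℂ = α ((n : ℤ) - k))
    (_ : ∀ n k : ℕ, ⟪b n, Tg (b k)⟫_ℂ = β ((n : ℤ) - k)) (t : ℂ)
    (_ : HasSum (fun j : ℕ => β (p + j + 1) * α (-(q + j + 1))) t),
    HasSum (fun m : ℤ => β (p - m) * α (m - q)) (⟪b p, Tg (Tf (b q))⟫_ℂ + t) := by
    intro α β Tf Tg hTf hTg t ht
    refine HasSum.of_nat_of_neg_add_one ?_ ?_
    · have := b.hasSum_inner_mul_inner (ContinuousLinearMap.adjoint Tg (b p)) (Tf (b q))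
      simp only [ContinuousLinearMap.adjoint_inner_left, hTf, hTg] at this
      exact this
    · convert ht using 2 with j
      congr 2 <;> ring
  have h1 := prod α β Tf Tg hTf hTg t ht
  have h2 := prod β α Tg Tf hTg hTf s hs
  have h3 : HasSum (fun m : ℤ => α (p - m) * β (m - q)) (⟪b p, Tg (Tf (b q))⟫_ℂ + t) := by
    have := (Equiv.subLeft ((p : ℤ) + q)).hasSum_iff.2 h1
    convert this using 2 with m
    simp only [Function.comp, Equiv.subLeft_apply]
    rw [mul_comm]
    congr 2 <;> ring
  have h4 := h3.unique h2
  simp only [ContinuousLinearMap.sub_apply, ContinuousLinearMap.comp_apply, inner_sub_right]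
  linear_combination h4

/-- For real-valued `f ∈ C³(𝕋)`, `g ∈ C²(𝕋)`, the bounded
extension of `[T_g,T_f] X + X [T_g,T_f]` is a compact operator. -/
theorem stmt_8 (e : ℕ → E) (he : IsONBasis e)
    (f g : ℝ → ℝ) (hf : ContDiff ℝ 3 f) (hg : ContDiff ℝ 2 g)
    (hfp : Function.Periodic f (2 * Real.pi)) (hgp : Function.Periodic g (2 * Real.pi))
    (Tf Tg : E →L[ℂ] E)
    (hTf : IsToeplitz e (fun x => Complex.ofReal (f x)) Tf)
    (hTg : IsToeplitz e (fun x => Complex.ofReal (g x)) Tg) :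
    ∃ B : E →L[ℂ] E,
      (∀ p q : ℕ, ⟪e p, B (e q)⟫_ℂ =
        ((p : ℂ) + (q : ℂ) + 2) * ⟪e p, (Tg ∘L Tf - Tf ∘L Tg) (e q)⟫_ℂ) ∧
      IsCompactOperator ⇑B := by
  obtain ⟨b, rfl⟩ : ∃ b : HilbertBasis ℕ ℂ E, ⇑b = e :=
    ⟨HilbertBasis.mk he.1 he.2.ge, HilbertBasis.coe_mk _ _⟩
  obtain ⟨C, hC, hα⟩ := fcoef_decay 3 f hf hfp
  obtain ⟨D, hD, hβ⟩ := fcoef_decay 2 g hg hgp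
  unfold IsToeplitz at hTf hTg
  generalize fcoef (fun x => Complex.ofReal (f x)) = α at *
  generalize fcoef (fun x => Complex.ofReal (g x)) = β at *
  -- decay along `±(p+j+1)`
  have habs : ∀ (m : ℤ) (p j : ℕ), (m = p + j + 1 ∨ m = -(p + j + 1)) →
      |(m : ℝ)| = (p : ℝ) + j + 1 := by
    intro m p j h
    have h0 : (0 : ℝ) ≤ (p : ℝ) + j + 1 := by positivity
    rcases h with rfl | rfl
    · push_cast; exact abs_of_nonneg h0
    · push_cast; rw [abs_neg]; exact abs_of_nonneg h0
  -- the four pointwise bounds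
  have bα1 : ∀ (m : ℤ) (p j : ℕ), (m = p + j + 1 ∨ m = -(p + j + 1)) →
      ‖((p : ℂ) + 1) * α m‖ ≤ (C / (j + 1)) / (p + 1) := by
    intro m p j h
    have h1 := hα m
    rw [habs m p j h] at h1
    have h2 : ‖((p : ℂ) + 1)‖ = (p : ℝ) + 1 := by
      have := Complex.norm_natCast (p + 1); push_cast at this; exact this
    rw [norm_mul, h2, div_div, le_div_iff₀ (by positivity)]
    refine le_trans ?_ h1
    have h3 : ((p : ℝ) + 1) * ((j + 1) * (p + 1)) ≤ ((p : ℝ) + j + 1) ^ 3 := by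
      have hp : (0 : ℝ) ≤ p := by positivity
      have hj : (0 : ℝ) ≤ j := by positivity
      calc ((p : ℝ) + 1) * ((j + 1) * (p + 1))
          ≤ ((p : ℝ) + j + 1) * (((p : ℝ) + j + 1) * ((p : ℝ) + j + 1)) := by gcongr <;> linarith
        _ = _ := by ring
    calc ((p : ℝ) + 1) * ‖α m‖ * ((j + 1) * (p + 1))
        = (((p : ℝ) + 1) * ((j + 1) * (p + 1))) * ‖α m‖ := by ring
      _ ≤ _ := by gcongr
  have bα0 : ∀ (m : ℤ) (p j : ℕ), (m = p + j + 1 ∨ m = -(p + j + 1)) →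
      ‖α m‖ ≤ (C / (j + 1) ^ 2) / (p + 1) := by
    intro m p j h
    have h1 := hα m
    rw [habs m p j h] at h1
    rw [div_div, le_div_iff₀ (by positivity)]
    refine le_trans ?_ h1
    rw [mul_comm]
    gcongr
    have hp : (0 : ℝ) ≤ p := by positivity
    have hj : (0 : ℝ) ≤ j := by positivity
    calc ((j : ℝ) + 1) ^ 2 * (p + 1)
        ≤ ((p : ℝ) + j + 1) ^ 2 * ((p : ℝ) + j + 1) := by gcongr <;> linarith
      _ = _ := by ring
  have bβ1 : ∀ (m : ℤ) (p j : ℕ), (m = p + j + 1 ∨ m = -(p + j + 1)) →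
      ‖((p : ℂ) + 1) * β m‖ ≤ D / (p + 1) := by
    intro m p j h
    have h1 := hβ m
    rw [habs m p j h] at h1
    have h2 : ‖((p : ℂ) + 1)‖ = (p : ℝ) + 1 := by
      have := Complex.norm_natCast (p + 1); push_cast at this; exact this
    rw [norm_mul, h2, le_div_iff₀ (by positivity)]
    refine le_trans ?_ h1
    have hj : (0 : ℝ) ≤ j := by positivity
    calc ((p : ℝ) + 1) * ‖β m‖ * (p + 1) = ((p : ℝ) + 1) ^ 2 * ‖β m‖ := by ring
      _ ≤ _ := by gcongr; linarith
  have bβ0 : ∀ (m : ℤ) (p j : ℕ), (m = p + j + 1 ∨ m = -(p + j + 1)) →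
      ‖β m‖ ≤ (D / (j + 1)) / (p + 1) := by
    intro m p j h
    have h1 := hβ m
    rw [habs m p j h] at h1
    rw [div_div, le_div_iff₀ (by positivity)]
    refine le_trans ?_ h1
    rw [mul_comm]
    gcongr
    have hp : (0 : ℝ) ≤ p := by positivity
    have hj : (0 : ℝ) ≤ j := by positivity
    calc ((j : ℝ) + 1) * (p + 1)
        ≤ ((p : ℝ) + j + 1) * ((p : ℝ) + j + 1) := by gcongr <;> linarith
      _ = _ := by ring
  have hsum : Summable (fun j : ℕ => 1 / ((j : ℝ) + 1) ^ 2) := by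
    have := (summable_nat_add_iff 1).2 (Real.summable_one_div_nat_pow.2 (by norm_num : 1 < 2))
    simpa using this
  have hs1 : Summable (fun j : ℕ => C / ((j : ℝ) + 1) * (D / ((j : ℝ) + 1))) := by
    refine (hsum.mul_left (C * D)).congr fun j => ?_
    field_simp
  have hs1' : Summable (fun j : ℕ => D / ((j : ℝ) + 1) * (C / ((j : ℝ) + 1))) :=
    hs1.congr fun j => mul_comm _ _
  have hs2 : Summable (fun j : ℕ => C / ((j : ℝ) + 1) ^ 2 * D) := by
    refine (hsum.mul_left (C * D)).congr fun j => ?_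
    field_simp
  have hs2' : Summable (fun j : ℕ => D * (C / ((j : ℝ) + 1) ^ 2)) :=
    hs2.congr fun j => mul_comm _ _
  obtain ⟨B1, hB1, h1⟩ := exists_compact b
    (fun j p => ((p : ℂ) + 1) * α (p + j + 1)) (fun j q => β (-(q + j + 1)))
    (fun j => C / (j + 1)) (fun j => D / (j + 1)) (fun j => by positivity) (fun j => by positivity)
    (fun j p => bα1 _ p j (Or.inl rfl)) (fun j p => bβ0 _ p j (Or.inr rfl)) hs1
  obtain ⟨B2, hB2, h2⟩ := exists_compact b
    (fun j p => α (p + j + 1)) (fun j q => ((q : ℂ) + 1) * β (-(q + j + 1)))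
    (fun j => C / (j + 1) ^ 2) (fun _ => D) (fun j => by positivity) (fun j => by positivity)
    (fun j p => bα0 _ p j (Or.inl rfl)) (fun j p => bβ1 _ p j (Or.inr rfl)) hs2
  obtain ⟨B3, hB3, h3⟩ := exists_compact b
    (fun j p => ((p : ℂ) + 1) * β (p + j + 1)) (fun j q => α (-(q + j + 1)))
    (fun _ => D) (fun j => C / (j + 1) ^ 2) (fun j => by positivity) (fun j => by positivity)
    (fun j p => bβ1 _ p j (Or.inl rfl)) (fun j p => bα0 _ p j (Or.inr rfl)) hs2'
  obtain ⟨B4, hB4, h4⟩ := exists_compact b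
    (fun j p => β (p + j + 1)) (fun j q => ((q : ℂ) + 1) * α (-(q + j + 1)))
    (fun j => D / (j + 1)) (fun j => C / (j + 1)) (fun j => by positivity) (fun j => by positivity)
    (fun j p => bβ0 _ p j (Or.inl rfl)) (fun j p => bα1 _ p j (Or.inr rfl)) hs1'
  refine ⟨(B1 + B2) - (B3 + B4), fun p q => ?_, (hB1.add hB2).sub (hB3.add hB4)⟩
  have hp0 : ((p : ℂ) + 1) ≠ 0 := Nat.cast_add_one_ne_zero p
  have S1 : HasSum (fun j : ℕ => α (p + j + 1) * β (-(q + j + 1)))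
      (((p : ℂ) + 1)⁻¹ * ⟪b p, B1 (b q)⟫_ℂ) := by
    refine hasSum_congr_aux (fun j => ?_) ((h1 p q).mul_left (((p : ℂ) + 1)⁻¹))
    field_simp
  have S3 : HasSum (fun j : ℕ => β (p + j + 1) * α (-(q + j + 1)))
      (((p : ℂ) + 1)⁻¹ * ⟪b p, B3 (b q)⟫_ℂ) := by
    refine hasSum_congr_aux (fun j => ?_) ((h3 p q).mul_left (((p : ℂ) + 1)⁻¹))
    field_simp
  have key := commutator_hasSum b α β Tf Tg hTf hTg p q _ _ S1 S3
  have E2 : ⟪b p, B2 (b q)⟫_ℂ = ((q : ℂ) + 1) * (((p : ℂ) + 1)⁻¹ * ⟪b p, B1 (b q)⟫_ℂ) := by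
    refine (h2 p q).unique ?_
    refine hasSum_congr_aux (fun j => ?_) (S1.mul_left ((q : ℂ) + 1))
    ring
  have E4 : ⟪b p, B4 (b q)⟫_ℂ = ((q : ℂ) + 1) * (((p : ℂ) + 1)⁻¹ * ⟪b p, B3 (b q)⟫_ℂ) := by
    refine (h4 p q).unique ?_
    refine hasSum_congr_aux (fun j => ?_) (S3.mul_left ((q : ℂ) + 1))
    ring
  rw [key]
  simp only [ContinuousLinearMap.sub_apply, ContinuousLinearMap.add_apply, inner_sub_right,
    inner_add_right]
  rw [E2, E4]
  field_simp
  ring
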